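/- Let g ∈ S₀(ℝ) and let Λ ⊆ ℝ² be a lattice such that (g, Λ) is a frame for its closed linear span 𝒢 = 𝒢(g, Λ). If 𝔍(𝒢) ≠ Λ, then there exist a matrix B ∈ ℝ^{2×2} with det B = 1, reals α, β > 0 with BΛ = αℤ×βℤ, an integer m ≥ 2, and a unitary operator U : L²(ℝ) → L²(ℝ) satisfying U ∘ ρ(z) = ρ(Bz) ∘ U for all z ∈ ℝ² (where ρ(a,b) = e^{πiab} π(a,b)), such that Ug ∈ S₀(ℝ), the system (Ug, αℤ×βℤ) is a frame for its closed linear span 𝒢' = 𝒢(Ug, αℤ×βℤ), and T_{α/m}(Ug) ∈ 𝒢'. -/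

import Mathlib

open MeasureTheory Complex Filter
open scoped ENNReal InnerProductSpace RealInnerProductSpace ComplexConjugate

noncomputable section

/-- The Hilbert space `L²(ℝ)` of complex-valued square-integrable functions. -/
abbrev L2 : Type := Lp ℂ 2 (volume : Measure ℝ)

lemma memLp_translate (a : ℝ) (f : L2) :
    MemLp (fun x : ℝ => f (x - a)) 2 (volume : Measure ℝ) :=
  (Lp.memLp f).comp_measurePreserving (measurePreserving_sub_right volume a)

lemma memLp_modulate (b : ℝ) (f : L2) :
    MemLp (fun x : ℝ => Complex.exp (2 * Real.pi * Complex.I * (b * x)) * f x) 2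
      (volume : Measure ℝ) := by
  refine MemLp.of_le (Lp.memLp f) ?_ ?_
  · exact (Complex.continuous_exp.comp (by fun_prop)).aestronglyMeasurable.mul
      (Lp.aestronglyMeasurable f)
  · filter_upwards with x
    have : Complex.exp (2 * Real.pi * Complex.I * (b * x))
        = Complex.exp ((2 * Real.pi * (b * x) : ℝ) * Complex.I) := by
      push_cast; ring_nf
    rw [norm_mul, this, Complex.norm_exp_ofReal_mul_I, one_mul]

/-- Translation `T_a` on `L²(ℝ)`: `(T_a f)(x) = f (x - a)`. -/
def Tr (a : ℝ) (f : L2) : L2 := (memLp_translate a f).toLp _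

/-- Modulation `M_b` on `L²(ℝ)`: `(M_b f)(x) = e^{2πibx} f x`. -/
def Mo (b : ℝ) (f : L2) : L2 := (memLp_modulate b f).toLp _

/-- Time-frequency shift `π(a,b) = T_a M_b`. -/
def tf (z : ℝ × ℝ) (f : L2) : L2 := Tr z.1 (Mo z.2 f)

/-- The closed linear span `𝒢(g,Λ)` of the Gabor system `(g,Λ)`. -/
def gaborSpan (g : L2) (Λ : Set (ℝ × ℝ)) : Set L2 :=
  closure (Submodule.span ℂ ((fun z => tf z g) '' Λ) : Set L2)

/-- `𝔍(𝒢)`: the set of time-frequency shifts leaving `𝒢` invariant. -/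
def stab (G : Set L2) : Set (ℝ × ℝ) := {z | ∀ f ∈ G, tf z f ∈ G}

/-- `Λ` is a lattice in `ℝ²` if `Λ = Aℤ²` for an invertible `2×2` matrix `A`. -/
def IsLattice (Λ : Set (ℝ × ℝ)) : Prop :=
  ∃ A : Matrix (Fin 2) (Fin 2) ℝ, IsUnit A.det ∧
    Λ = {p : ℝ × ℝ | ∃ k l : ℤ,
      p = (A 0 0 * k + A 0 1 * l, A 1 0 * k + A 1 1 * l)}

lemma memLp_gaussian : MemLp (fun x : ℝ => (Real.exp (-Real.pi * x ^ 2) : ℂ)) 2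
    (volume : Measure ℝ) := by
  rw [memLp_two_iff_integrable_sq_norm]
  · have h : Integrable (fun x : ℝ => Real.exp (-(2 * Real.pi) * x ^ 2)) volume :=
      integrable_exp_neg_mul_sq (by positivity)
    refine h.congr (Eventually.of_forall fun x => ?_)
    simp only [Complex.norm_real, Real.norm_eq_abs, Real.abs_exp, sq, ← Real.exp_add]
    ring_nf
  · exact (Complex.continuous_ofReal.comp (by fun_prop)).aestronglyMeasurable

/-- The Gaussian `φ(x) = e^{-πx²}` as an element of `L²(ℝ)`. -/
def gaussL2 : L2 := memLp_gaussian.toLp _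

/-- The Feichtinger algebra condition: `f ∈ S₀(ℝ)` iff `(a,b) ↦ ⟨f, π(a,b)φ⟩ ∈ L¹(ℝ²)`. -/
def InS0 (f : L2) : Prop :=
  Integrable (fun z : ℝ × ℝ => ⟪tf z gaussL2, f⟫_ℂ) (volume : Measure (ℝ × ℝ))

/-- `(g,Λ)` is a frame for its closed linear span. -/
def IsFrameSeq (g : L2) (Λ : Set (ℝ × ℝ)) : Prop :=
  ∃ A B : ℝ, 0 < A ∧ 0 < B ∧ ∀ f ∈ gaborSpan g Λ,
    A * ‖f‖ ^ 2 ≤ ∑' lam : Λ, ‖⟪tf (lam : ℝ × ℝ) g, f⟫_ℂ‖ ^ 2 ∧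
    ∑' lam : Λ, ‖⟪tf (lam : ℝ × ℝ) g, f⟫_ℂ‖ ^ 2 ≤ B * ‖f‖ ^ 2

/-- `(g,Λ)` is a frame for all of `L²(ℝ)`. -/
def IsFrameL2 (g : L2) (Λ : Set (ℝ × ℝ)) : Prop :=
  ∃ A B : ℝ, 0 < A ∧ 0 < B ∧ ∀ f : L2,
    A * ‖f‖ ^ 2 ≤ ∑' lam : Λ, ‖⟪tf (lam : ℝ × ℝ) g, f⟫_ℂ‖ ^ 2 ∧
    ∑' lam : Λ, ‖⟪tf (lam : ℝ × ℝ) g, f⟫_ℂ‖ ^ 2 ≤ B * ‖f‖ ^ 2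

/-- Euclidean ball of radius `ε` around `a ∈ ℝ²`. -/
def eball (ε : ℝ) (a : ℝ × ℝ) : Set (ℝ × ℝ) :=
  {x : ℝ × ℝ | Real.sqrt ((x.1 - a.1) ^ 2 + (x.2 - a.2) ^ 2) < ε}

/-- `B_ε(Δ) = ⋃_{a ∈ Δ} B_ε(a)`. -/
def eballSet (ε : ℝ) (Δ : Set (ℝ × ℝ)) : Set (ℝ × ℝ) := ⋃ a ∈ Δ, eball ε a

/-- The separable lattice `αℤ × βℤ`. -/
def sepLattice (α β : ℝ) : Set (ℝ × ℝ) :=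
  {p : ℝ × ℝ | ∃ k l : ℤ, p = (α * k, β * l)}


/-- `ρ(a,b) = e^{πiab} π(a,b)`. -/
def rho (z : ℝ × ℝ) (f : L2) : L2 :=
  Complex.exp (Real.pi * Complex.I * (z.1 * z.2)) • tf z f

lemma exists_nsmul_near_int (z : ℝ × ℝ) {ε : ℝ} (hε : 0 < ε) :
    ∃ n : ℕ, 0 < n ∧ ∃ k l : ℤ, ‖n • z - ((k : ℝ), (l : ℝ))‖ < ε := by
  have hK : IsCompact (Set.Icc (0 : ℝ) 1 ×ˢ Set.Icc (0 : ℝ) 1) := isCompact_Icc.prod isCompact_Icc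
  obtain ⟨a, -, φ, hφ, ha⟩ := hK.tendsto_subseq
    (x := fun n : ℕ => (Int.fract (n * z.1), Int.fract (n * z.2))) fun n =>
      ⟨⟨Int.fract_nonneg _, (Int.fract_lt_one _).le⟩, ⟨Int.fract_nonneg _, (Int.fract_lt_one _).le⟩⟩
  obtain ⟨N, hN⟩ := Metric.cauchySeq_iff.1 ha.cauchySeq ε hε
  have hlt : φ N < φ (N + 1) := hφ (Nat.lt_succ_self N)
  have h := hN (N + 1) (Nat.le_succ N) N le_rfl
  refine ⟨φ (N + 1) - φ N, Nat.sub_pos_of_lt hlt, ⌊(φ (N + 1) : ℝ) * z.1⌋ - ⌊(φ N : ℝ) * z.1⌋,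
    ⌊(φ (N + 1) : ℝ) * z.2⌋ - ⌊(φ N : ℝ) * z.2⌋, ?_⟩
  rw [dist_eq_norm] at h
  refine lt_of_eq_of_lt (congrArg norm ?_) h
  ext <;> simp [Int.fract, Nat.cast_sub hlt.le, -Int.self_sub_floor] <;> ring

lemma neg_mem_of_closed_of_add_mem {S : Set (ℝ × ℝ)} (hcl : IsClosed S)
    (hadd : ∀ x ∈ S, ∀ y ∈ S, x + y ∈ S) (hZ : ∀ k l : ℤ, ((k : ℝ), (l : ℝ)) ∈ S)
    {z : ℝ × ℝ} (hz : z ∈ S) : -z ∈ S := by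
  have hnsmul : ∀ n : ℕ, n • z ∈ S := by
    intro n
    induction n with
    | zero => simpa [← Prod.zero_eq_mk] using hZ 0 0
    | succ n ih => rw [succ_nsmul]; exact hadd _ ih _ hz
  rw [← hcl.closure_eq, Metric.mem_closure_iff]
  intro ε hε
  obtain ⟨n, hn, k, l, h⟩ := exists_nsmul_near_int z hε
  refine ⟨(n - 1) • z + (((-k : ℤ) : ℝ), ((-l : ℤ) : ℝ)), hadd _ (hnsmul _) _ (hZ _ _), ?_⟩
  rw [dist_comm, dist_eq_norm]
  refine lt_of_eq_of_lt (congrArg norm ?_) h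
  obtain ⟨m, rfl⟩ : ∃ m, n = m + 1 := ⟨n - 1, by omega⟩
  ext <;> simp <;> ring

/-- A closed subgroup with arbitrarily small nonzero elements contains a line. -/
lemma exists_line_le_of_small_elements {E : Type*} [NormedAddCommGroup E] [NormedSpace ℝ E]
    [FiniteDimensional ℝ E] (H : AddSubgroup E) (hcl : IsClosed (H : Set E))
    (hsmall : ∀ ε > 0, ∃ w ∈ H, w ≠ 0 ∧ ‖w‖ < ε) :
    ∃ u : E, u ≠ 0 ∧ ∀ t : ℝ, t • u ∈ H := by
  choose w hwH hw0 hw using fun n : ℕ => hsmall (1 / ((n : ℝ) + 1)) (by positivity)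
  have hwlim : Tendsto (fun n => ‖w n‖) atTop (nhds 0) :=
    squeeze_zero (fun n => norm_nonneg _) (fun n => (hw n).le) tendsto_one_div_add_atTop_nhds_zero_nat
  have : ProperSpace E := FiniteDimensional.proper_real E
  obtain ⟨u, hu, φ, hφ, hlim⟩ := (isCompact_sphere (0 : E) 1).tendsto_subseq
    (x := fun n => ‖w n‖⁻¹ • w n) (fun n => by simp [norm_smul, hw0 n])
  refine ⟨u, fun h => by simp [h] at hu, fun t => ?_⟩
  have hcoef : Tendsto (fun n => (⌊t / ‖w (φ n)‖⌋ : ℝ) * ‖w (φ n)‖) atTop (nhds t) := by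
    have h0 := hwlim.comp hφ.tendsto_atTop
    refine tendsto_of_tendsto_of_tendsto_of_le_of_le
      (g := fun n => t - ‖w (φ n)‖) (h := fun _ => t) ?_ tendsto_const_nhds ?_ ?_
    · simpa using tendsto_const_nhds.sub h0
    · intro n
      have hpos : 0 < ‖w (φ n)‖ := norm_pos_iff.2 (hw0 _)
      have := Int.lt_floor_add_one (t / ‖w (φ n)‖)
      rw [div_lt_iff₀ hpos] at this
      simp only
      linarith
    · intro n
      have hpos : 0 < ‖w (φ n)‖ := norm_pos_iff.2 (hw0 _)
      exact (le_div_iff₀ hpos).1 (Int.floor_le _)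
  refine hcl.mem_of_tendsto (hcoef.smul hlim) (Eventually.of_forall fun n => ?_)
  have hpos : ‖w (φ n)‖ ≠ 0 := norm_ne_zero_iff.2 (hw0 _)
  have : ((⌊t / ‖w (φ n)‖⌋ : ℝ) * ‖w (φ n)‖) • (‖w (φ n)‖⁻¹ • w (φ n))
      = ⌊t / ‖w (φ n)‖⌋ • w (φ n) := by
    rw [smul_smul, mul_assoc, mul_inv_cancel₀ hpos, mul_one, Int.cast_smul_eq_zsmul]
  simp only [Function.comp_apply]
  rw [this]
  exact H.zsmul_mem (hwH _) _

lemma exists_coprime_half_mem_of_line (H : AddSubgroup (ℝ × ℝ)) (hcl : IsClosed (H : Set (ℝ × ℝ)))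
    (hZ : ∀ k l : ℤ, ((k : ℝ), (l : ℝ)) ∈ H) {u : ℝ × ℝ} (hu : u ≠ 0)
    (hline : ∀ t : ℝ, t • u ∈ H) :
    ∃ p q : ℤ, IsCoprime p q ∧ ((p : ℝ) / 2, (q : ℝ) / 2) ∈ H := by
  by_cases hu1 : u.1 = 0
  · have hu2 : u.2 ≠ 0 := fun h => hu (Prod.ext hu1 h)
    refine ⟨0, 1, isCoprime_zero_left.2 isUnit_one, ?_⟩
    convert hline (1 / (2 * u.2)) using 1
    ext <;> simp [hu1]
    field_simp
  · by_cases hirr : Irrational (u.2 / u.1)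
    · refine ⟨0, 1, isCoprime_zero_left.2 isUnit_one, ?_⟩
      let V : AddSubgroup ℝ := H.comap (AddMonoidHom.inr ℝ ℝ)
      have hVcl : IsClosed (V : Set ℝ) := hcl.preimage (Continuous.prodMk_right 0)
      have h1 : (1 : ℝ) ∈ V := by
        change ((0 : ℝ), (1 : ℝ)) ∈ H
        simpa using hZ 0 1
      have h2 : u.2 / u.1 ∈ V := by
        change ((0 : ℝ), u.2 / u.1) ∈ H
        convert H.sub_mem (hline (1 / u.1)) (hZ 1 0) using 1
        ext
        · simp [hu1]
        · simp; ring
      have hdense : Dense (V : Set ℝ) := by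
        have := (dense_addSubgroupClosure_pair_iff (a := u.2 / u.1) (b := 1)).2 (by simpa using hirr)
        refine this.mono ?_
        rw [SetLike.coe_subset_coe, AddSubgroup.closure_le]
        rintro x (rfl | rfl)
        exacts [h2, h1]
      have : (1 / 2 : ℝ) ∈ (V : Set ℝ) := by
        rw [← hVcl.closure_eq, hdense.closure_eq]; trivial
      simpa [V] using this
    · obtain ⟨r, hr⟩ := not_not.1 hirr
      refine ⟨r.den, r.num, ?_, ?_⟩
      · have := r.reduced
        rw [Int.isCoprime_iff_gcd_eq_one, Int.gcd_comm]
        simpa [Nat.Coprime, Int.gcd] using this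
      · convert hline (r.den / (2 * u.1)) using 1
        have hden : (r.den : ℝ) ≠ 0 := by exact_mod_cast r.den_nz
        have hnum : (r.num : ℝ) = r.den * (u.2 / u.1) := by
          rw [← hr, Rat.cast_def]; field_simp
        ext
        · simp; field_simp
        · simp [hnum]; field_simp

lemma exists_coprime_div_mem_of_torsion (H : AddSubgroup (ℝ × ℝ))
    (hZ : ∀ k l : ℤ, ((k : ℝ), (l : ℝ)) ∈ H) {z : ℝ × ℝ} (hz : z ∈ H)
    (hnz : ¬ ∃ k l : ℤ, z = ((k : ℝ), (l : ℝ)))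
    (htor : ∃ n : ℕ, 0 < n ∧ ∃ k l : ℤ, n • z = ((k : ℝ), (l : ℝ))) :
    ∃ p q : ℤ, IsCoprime p q ∧ ∃ m : ℕ, 2 ≤ m ∧ ((p : ℝ) / m, (q : ℝ) / m) ∈ H := by
  classical
  obtain ⟨hN0, k, l, hkl⟩ := Nat.find_spec htor
  have hmin := fun {n : ℕ} => Nat.find_min htor (m := n)
  set N := Nat.find htor with hN
  have hN2 : 2 ≤ N := by
    by_contra h
    have : N = 1 := by omega
    exact hnz ⟨k, l, by simpa [this] using hkl⟩
  have hNR : (N : ℝ) ≠ 0 := by exact_mod_cast hN0.ne'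
  have hk : (N : ℝ) * z.1 = k := by simpa using congrArg Prod.fst hkl
  have hl : (N : ℝ) * z.2 = l := by simpa using congrArg Prod.snd hkl
  have hgpos : 0 < Int.gcd k l := by
    rw [Nat.pos_iff_ne_zero, Ne, Int.gcd_eq_zero_iff]
    rintro ⟨rfl, rfl⟩
    simp [hNR] at hk hl
    exact hnz ⟨0, 0, Prod.ext (by simpa using hk) (by simpa using hl)⟩
  obtain ⟨p, q, hpq, hkp, hlq⟩ := Int.exists_gcd_one hgpos
  set d := Int.gcd k l
  have hdN : IsCoprime (d : ℤ) (N : ℤ) := by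
    rw [Nat.isCoprime_iff_coprime]
    by_contra hc
    obtain ⟨e, he, ⟨d', hd'⟩, ⟨N', hN'⟩⟩ := Nat.Prime.not_coprime_iff_dvd.1 hc
    have heR : (e : ℝ) ≠ 0 := by exact_mod_cast he.ne_zero
    have hN'0 : 0 < N' := Nat.pos_of_ne_zero fun h => by simp [h] at hN'; omega
    refine hmin (n := N') ?_ ⟨hN'0, p * d', q * d', ?_⟩
    · rw [hN']; exact lt_mul_of_one_lt_left hN'0 he.one_lt
    · rw [hkp, hN', hd'] at hk
      rw [hlq, hN', hd'] at hl
      push_cast at hk hl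
      ext
      · rw [Prod.smul_fst, nsmul_eq_mul]
        push_cast
        exact mul_left_cancel₀ heR (by linarith)
      · rw [Prod.smul_snd, nsmul_eq_mul]
        push_cast
        exact mul_left_cancel₀ heR (by linarith)
  obtain ⟨x, y, hxy⟩ := hdN
  have hxyR : (x : ℝ) * d + y * N = 1 := by exact_mod_cast hxy
  refine ⟨p, q, Int.isCoprime_iff_gcd_eq_one.2 hpq, N, hN2, ?_⟩
  convert H.add_mem (H.zsmul_mem hz x) (hZ (y * p) (y * q)) using 1
  rw [hkp] at hk
  rw [hlq] at hl
  push_cast at hk hl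
  ext
  · rw [Prod.fst_add, Prod.smul_fst, zsmul_eq_mul]
    push_cast
    rw [div_eq_iff hNR]
    linear_combination (-p : ℝ) * hxyR - x * hk
  · rw [Prod.snd_add, Prod.smul_snd, zsmul_eq_mul]
    push_cast
    rw [div_eq_iff hNR]
    linear_combination (-q : ℝ) * hxyR - x * hl

/-- A closed subgroup of `ℝ²` properly containing `ℤ²` contains a nontrivial fraction of a
primitive integer vector. -/
lemma exists_coprime_div_mem (H : AddSubgroup (ℝ × ℝ)) (hcl : IsClosed (H : Set (ℝ × ℝ)))
    (hZ : ∀ k l : ℤ, ((k : ℝ), (l : ℝ)) ∈ H) {z : ℝ × ℝ} (hz : z ∈ H)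
    (hnz : ¬ ∃ k l : ℤ, z = ((k : ℝ), (l : ℝ))) :
    ∃ p q : ℤ, IsCoprime p q ∧ ∃ m : ℕ, 2 ≤ m ∧ ((p : ℝ) / m, (q : ℝ) / m) ∈ H := by
  by_cases htor : ∃ n : ℕ, 0 < n ∧ ∃ k l : ℤ, n • z = ((k : ℝ), (l : ℝ))
  · exact exists_coprime_div_mem_of_torsion H hZ hz hnz htor
  · obtain ⟨u, hu, hline⟩ := exists_line_le_of_small_elements H hcl fun ε hε => by
      obtain ⟨n, hn, k, l, h⟩ := exists_nsmul_near_int z hε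
      exact ⟨_, H.sub_mem (H.nsmul_mem hz n) (hZ k l),
        fun h0 => htor ⟨n, hn, k, l, sub_eq_zero.1 h0⟩, h⟩
    obtain ⟨p, q, hpq, h⟩ := exists_coprime_half_mem_of_line H hcl hZ hu hline
    exact ⟨p, q, hpq, 2, le_rfl, by exact_mod_cast h⟩

lemma coeFn_Tr (a : ℝ) (f : L2) : Tr a f =ᵐ[volume] fun x => f (x - a) := MemLp.coeFn_toLp _

lemma coeFn_Mo (b : ℝ) (f : L2) :
    Mo b f =ᵐ[volume] fun x => Complex.exp (2 * Real.pi * Complex.I * (b * x)) * f x :=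
  MemLp.coeFn_toLp _

lemma ae_comp_sub {p : ℝ → Prop} (h : ∀ᵐ x, p x) (a : ℝ) : ∀ᵐ x, p (x - a) :=
  (measurePreserving_sub_right volume a).quasiMeasurePreserving.ae h

lemma coeFn_tf (z : ℝ × ℝ) (f : L2) : tf z f =ᵐ[volume]
    fun x => Complex.exp (2 * Real.pi * Complex.I * (z.2 * (x - z.1))) * f (x - z.1) := by
  filter_upwards [coeFn_Tr z.1 (Mo z.2 f), ae_comp_sub (coeFn_Mo z.2 f) z.1] with x h1 h2
  rw [tf, h1, h2]
  push_cast
  rfl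

lemma memLp_circle_mul (u : C(ℝ, Circle)) (f : L2) :
    MemLp (fun x : ℝ => (u x : ℂ) * f x) 2 (volume : Measure ℝ) := by
  refine MemLp.of_le (Lp.memLp f) ?_ (Eventually.of_forall fun x => by
    rw [norm_mul, Circle.norm_coe, one_mul])
  exact (continuous_induced_dom.comp u.continuous).aestronglyMeasurable.mul
    (Lp.aestronglyMeasurable f)

/-- Multiplication by a continuous unimodular function, on `L²(ℝ)`. -/
def circleMul (u : C(ℝ, Circle)) (f : L2) : L2 := (memLp_circle_mul u f).toLp _

lemma coeFn_circleMul (u : C(ℝ, Circle)) (f : L2) :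
    circleMul u f =ᵐ[volume] fun x => (u x : ℂ) * f x := MemLp.coeFn_toLp _

lemma circleMul_circleMul (u v : C(ℝ, Circle)) (f : L2) :
    circleMul u (circleMul v f) = circleMul (u * v) f := by
  refine Lp.ext ?_
  filter_upwards [coeFn_circleMul u (circleMul v f), coeFn_circleMul v f,
    coeFn_circleMul (u * v) f] with x h1 h2 h3
  rw [h1, h2, h3]
  simp [mul_assoc]

lemma circleMul_one (f : L2) : circleMul 1 f = f := by
  refine Lp.ext ?_
  filter_upwards [coeFn_circleMul 1 f] with x h1
  simp [h1]

/-- Multiplication by a continuous unimodular function as a unitary operator on `L²(ℝ)`. -/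
def circleMulₗᵢ (u : C(ℝ, Circle)) : L2 ≃ₗᵢ[ℂ] L2 where
  toFun := circleMul u
  invFun := circleMul u⁻¹
  left_inv f := by rw [circleMul_circleMul, inv_mul_cancel, circleMul_one]
  right_inv f := by rw [circleMul_circleMul, mul_inv_cancel, circleMul_one]
  map_add' f g := by
    refine Lp.ext ?_
    filter_upwards [coeFn_circleMul u (f + g), coeFn_circleMul u f, coeFn_circleMul u g,
      Lp.coeFn_add f g, Lp.coeFn_add (circleMul u f) (circleMul u g)] with x h1 h2 h3 h4 h5
    rw [h1, h4, h5, Pi.add_apply, Pi.add_apply, h2, h3, mul_add]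
  map_smul' c f := by
    refine Lp.ext ?_
    filter_upwards [coeFn_circleMul u (c • f), coeFn_circleMul u f,
      Lp.coeFn_smul c f, Lp.coeFn_smul c (circleMul u f)] with x h1 h2 h3 h4
    simp [h1, h2, h3, h4, mul_left_comm]
  norm_map' f := by
    change ‖circleMul u f‖ = ‖f‖
    rw [Lp.norm_def, Lp.norm_def]
    congr 1
    refine eLpNorm_congr_norm_ae ?_
    filter_upwards [coeFn_circleMul u f] with x h1
    rw [h1, norm_mul, Circle.norm_coe, one_mul]

/-- The quadratic phase `x ↦ e^{πisx²}`. -/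
def quadPhase (s : ℝ) : C(ℝ, Circle) :=
  ⟨fun x => Circle.exp (Real.pi * s * x ^ 2), Circle.exp.continuous.comp (by fun_prop)⟩

lemma quadPhase_apply (s x : ℝ) :
    (quadPhase s x : ℂ) = Complex.exp (Real.pi * s * x ^ 2 * Complex.I) := by
  simp [quadPhase, Circle.coe_exp]

/-- The character `x ↦ e^{2πibx}`. -/
def charPhase (b : ℝ) : C(ℝ, Circle) :=
  ⟨fun x => Circle.exp (2 * Real.pi * (b * x)), Circle.exp.continuous.comp (by fun_prop)⟩

lemma Mo_eq_circleMul (b : ℝ) (f : L2) : Mo b f = circleMul (charPhase b) f := by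
  refine Lp.ext ?_
  filter_upwards [coeFn_Mo b f, coeFn_circleMul (charPhase b) f] with x h1 h2
  rw [h1, h2]
  simp only [charPhase, ContinuousMap.coe_mk, Circle.coe_exp]
  push_cast
  ring_nf

lemma Tr_eq_compMeasurePreserving (a : ℝ) (f : L2) :
    Tr a f = Lp.compMeasurePreservingₗᵢ ℂ (fun x => x - a)
      (measurePreserving_sub_right volume a) f := by
  refine Lp.ext ?_
  filter_upwards [coeFn_Tr a f, Lp.coeFn_compMeasurePreserving f
    (measurePreserving_sub_right volume a)] with x h1 h2
  rw [h1]
  exact h2.symm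

/-- The time-frequency shift as a linear isometry of `L²(ℝ)`. -/
def tfₗᵢ (z : ℝ × ℝ) : L2 →ₗᵢ[ℂ] L2 :=
  (Lp.compMeasurePreservingₗᵢ ℂ (fun x => x - z.1) (measurePreserving_sub_right volume z.1)).comp
    (circleMulₗᵢ (charPhase z.2)).toLinearIsometry

lemma tf_eq_tfₗᵢ (z : ℝ × ℝ) (f : L2) : tf z f = tfₗᵢ z f := by
  rw [tf, Tr_eq_compMeasurePreserving, Mo_eq_circleMul]
  rfl

lemma tf_smul (z : ℝ × ℝ) (c : ℂ) (f : L2) : tf z (c • f) = c • tf z f := by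
  simp [tf_eq_tfₗᵢ]

lemma inner_tf_tf (z : ℝ × ℝ) (f g : L2) : ⟪tf z f, tf z g⟫_ℂ = ⟪f, g⟫_ℂ := by
  simp only [tf_eq_tfₗᵢ, LinearIsometry.inner_map_map]

lemma tf_zero (f : L2) : tf 0 f = f := by
  refine Lp.ext ?_
  filter_upwards [coeFn_tf 0 f] with x h1
  simp [h1]

lemma tf_tf (z w : ℝ × ℝ) (f : L2) :
    tf z (tf w f) = Complex.exp (2 * Real.pi * Complex.I * (z.2 * w.1)) • tf (z + w) f := by
  refine Lp.ext ?_
  filter_upwards [coeFn_tf z (tf w f), ae_comp_sub (coeFn_tf w f) z.1, coeFn_tf (z + w) f,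
    Lp.coeFn_smul (Complex.exp (2 * Real.pi * Complex.I * (z.2 * w.1))) (tf (z + w) f)]
    with x h1 h2 h3 h4
  rw [h1, h2, h4, Pi.smul_apply, h3, smul_eq_mul]
  simp only [← mul_assoc, ← Complex.exp_add, Prod.fst_add, Prod.snd_add, sub_sub]
  congr 2
  push_cast
  ring

lemma tf_surjective (z : ℝ × ℝ) (f : L2) : ∃ f', tf z f' = f := by
  refine ⟨Complex.exp (2 * Real.pi * Complex.I * (z.2 * z.1)) • tf (-z) f, ?_⟩
  rw [tf_smul, tf_tf, add_neg_cancel, tf_zero, smul_smul, ← Complex.exp_add]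
  simp

lemma tf_Mo (z : ℝ × ℝ) (v : ℝ) (f : L2) : tf z (Mo v f) = tf (z + (0, v)) f := by
  have h := tf_tf z (0, v) f
  simp only [Complex.ofReal_zero, mul_zero, Complex.exp_zero, one_smul] at h
  rw [← h]
  congr 1
  refine Lp.ext ?_
  filter_upwards [coeFn_tf (0, v) f, coeFn_Mo v f] with x h1 h2
  simp [h1, h2]

lemma norm_exp_mul_I_eq_one {c : ℂ} (t : ℝ) (hc : c = t * Complex.I) : ‖Complex.exp c‖ = 1 := by
  rw [hc, Complex.norm_exp_ofReal_mul_I]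

lemma norm_rho_coeff (z : ℝ × ℝ) :
    ‖Complex.exp (Real.pi * Complex.I * (z.1 * z.2))‖ = 1 :=
  norm_exp_mul_I_eq_one (Real.pi * (z.1 * z.2)) (by push_cast; ring)

lemma tf_eq_smul_rho (z : ℝ × ℝ) (f : L2) :
    tf z f = (Complex.exp (Real.pi * Complex.I * (z.1 * z.2)))⁻¹ • rho z f := by
  rw [rho, inv_smul_smul₀ (Complex.exp_ne_zero _)]

/-- Multiplication by a quadratic phase intertwines `ρ` along a lower triangular shear. -/
lemma circleMul_quadPhase_rho (s : ℝ) (z : ℝ × ℝ) (f : L2) :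
    circleMul (quadPhase s) (rho z f) = rho (z.1, s * z.1 + z.2) (circleMul (quadPhase s) f) := by
  refine Lp.ext ?_
  unfold rho
  filter_upwards [coeFn_circleMul (quadPhase s)
      (Complex.exp (Real.pi * Complex.I * (z.1 * z.2)) • tf z f),
    Lp.coeFn_smul (Complex.exp (Real.pi * Complex.I * (z.1 * z.2))) (tf z f),
    coeFn_tf z f, coeFn_tf (z.1, s * z.1 + z.2) (circleMul (quadPhase s) f),
    Lp.coeFn_smul (Complex.exp (Real.pi * Complex.I * (z.1 * (s * z.1 + z.2 : ℝ))))
      (tf (z.1, s * z.1 + z.2) (circleMul (quadPhase s) f)),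
    ae_comp_sub (coeFn_circleMul (quadPhase s) f) z.1] with x h1 h2 h3 h4 h5 h6
  rw [h1, h2, h5, Pi.smul_apply, Pi.smul_apply, h3, h4, h6, quadPhase_apply, quadPhase_apply]
  simp only [smul_eq_mul, ← mul_assoc, ← Complex.exp_add]
  congr 2
  push_cast
  ring

lemma continuous_Tr (f : L2) : Continuous fun a : ℝ => Tr a f := by
  simp_rw [Tr_eq_compMeasurePreserving]
  let c : C(ℝ × ℝ, ℝ) := ⟨fun p => p.2 - p.1, by fun_prop⟩
  exact Continuous.compMeasurePreservingLp (f := fun _ : ℝ => f) (g := fun a => c.curry a)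
    continuous_const c.curry.continuous (fun a => measurePreserving_sub_right volume a) (by simp)

open scoped FourierTransform SchwartzMap

/-- The Fourier transform on `L²(ℝ)`. -/
abbrev fourierL2 : L2 ≃ₗᵢ[ℂ] L2 := Lp.fourierTransformₗᵢ ℝ ℂ

lemma integral_fourier_smul_eq_flip {f g : ℝ → ℂ} (hf : Integrable f) (hg : Integrable g) :
    ∫ x, 𝓕 f x • g x = ∫ x, f x • 𝓕 g x := by
  simpa using! VectorFourier.integral_fourierIntegral_smul_eq_flip (L := innerₗ ℝ)
    Real.continuous_fourierChar continuous_inner hf hg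

/-- On `L¹ ∩ L²` the `L²` Fourier transform is given by the Fourier integral. -/
lemma fourierL2_eq_of_ae {f h : L2} {F : ℝ → ℂ} (hf : f =ᵐ[volume] F) (hF : Integrable F)
    (hh : h =ᵐ[volume] 𝓕 F) : fourierL2 f = h := by
  have hinj := LinearMap.ker_eq_bot.1
    (Lp.ker_toTemperedDistributionCLM_eq_bot (E := ℝ) (F := ℂ) (μ := volume) (p := 2))
  apply hinj
  refine ContinuousLinearMap.ext fun θ => ?_
  change Lp.toTemperedDistribution (𝓕 f) θ = Lp.toTemperedDistribution h θ
  rw [← Lp.fourier_toTemperedDistribution_eq, TemperedDistribution.fourier_apply,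
    Lp.toTemperedDistribution_apply, Lp.toTemperedDistribution_apply]
  calc ∫ x, (𝓕 θ) x • f x = ∫ x, 𝓕 (θ : ℝ → ℂ) x • F x := by
        refine integral_congr_ae ?_
        filter_upwards [hf] with x hx
        rw [hx, SchwartzMap.fourier_coe]
    _ = ∫ x, θ x • 𝓕 F x := integral_fourier_smul_eq_flip θ.integrable hF
    _ = ∫ x, θ x • h x := by
        refine integral_congr_ae ?_
        filter_upwards [hh] with x hx
        rw [hx]

lemma fourierL2_ext {P Q : L2 → L2} (hP : Continuous P) (hQ : Continuous Q)
    (h : ∀ θ : 𝓢(ℝ, ℂ), P (θ.toLp 2) = Q (θ.toLp 2)) (f : L2) : P f = Q f :=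
  DenseRange.induction_on (p := fun f => P f = Q f)
    (SchwartzMap.denseRange_toLpCLM (F := ℂ) (E := ℝ) (μ := volume) (p := 2) ENNReal.ofNat_ne_top) f
    (isClosed_eq hP hQ) h

lemma continuous_Tr_right (a : ℝ) : Continuous (Tr a) := by
  rw [show Tr a = _ from funext (Tr_eq_compMeasurePreserving a)]
  exact LinearIsometry.continuous _

lemma continuous_Mo_right (b : ℝ) : Continuous (Mo b) := by
  rw [show Mo b = circleMulₗᵢ (charPhase b) from funext (Mo_eq_circleMul b)]
  exact LinearIsometryEquiv.continuous _

lemma coeFn_fourierL2_toLp (θ : 𝓢(ℝ, ℂ)) :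
    fourierL2 (θ.toLp 2) =ᵐ[volume] 𝓕 (θ : ℝ → ℂ) := by
  change (𝓕 (θ.toLp 2) : L2) =ᵐ[volume] _
  rw [SchwartzMap.toLp_fourier_eq]
  exact SchwartzMap.coeFn_toLp _ _ _

lemma fourierL2_Tr (a : ℝ) (f : L2) : fourierL2 (Tr a f) = Mo (-a) (fourierL2 f) := by
  refine fourierL2_ext (fourierL2.continuous.comp (continuous_Tr_right a))
    ((continuous_Mo_right _).comp fourierL2.continuous) (fun θ => ?_) f
  simp only [Function.comp_apply]
  refine fourierL2_eq_of_ae (F := fun x => θ (x - a)) ?_ (θ.integrable.comp_sub_right a) ?_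
  · filter_upwards [coeFn_Tr a (θ.toLp 2), ae_comp_sub (θ.coeFn_toLp 2 volume) a] with x h1 h2
    rw [h1, h2]
  · filter_upwards [coeFn_Mo (-a) (fourierL2 (θ.toLp 2)), coeFn_fourierL2_toLp θ] with x h1 h2
    rw [h1, h2, Real.fourier_real_eq_integral_exp_smul, Real.fourier_real_eq_integral_exp_smul,
      ← integral_const_mul, ← integral_sub_right_eq_self _ a]
    refine integral_congr_ae (Eventually.of_forall fun y => ?_)
    simp only [smul_eq_mul, ← mul_assoc, ← Complex.exp_add]
    congr 2
    push_cast
    ring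

lemma fourierL2_Mo (b : ℝ) (f : L2) : fourierL2 (Mo b f) = Tr b (fourierL2 f) := by
  refine fourierL2_ext (fourierL2.continuous.comp (continuous_Mo_right b))
    ((continuous_Tr_right _).comp fourierL2.continuous) (fun θ => ?_) f
  simp only [Function.comp_apply]
  refine fourierL2_eq_of_ae
    (F := fun x => Complex.exp (2 * Real.pi * Complex.I * (b * x)) * θ x) ?_ ?_ ?_
  · filter_upwards [coeFn_Mo b (θ.toLp 2), θ.coeFn_toLp 2 volume] with x h1 h2
    rw [h1, h2]
  · refine θ.integrable.mono (Continuous.aestronglyMeasurable (by fun_prop)) ?_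
    refine Eventually.of_forall fun x => ?_
    rw [norm_mul, norm_exp_mul_I_eq_one (2 * Real.pi * (b * x)) (by push_cast; ring), one_mul]
  · filter_upwards [coeFn_Tr b (fourierL2 (θ.toLp 2)), ae_comp_sub (coeFn_fourierL2_toLp θ) b]
      with x h1 h2
    rw [h1, h2, Real.fourier_real_eq_integral_exp_smul, Real.fourier_real_eq_integral_exp_smul]
    refine integral_congr_ae (Eventually.of_forall fun y => ?_)
    simp only [smul_eq_mul, ← mul_assoc, ← Complex.exp_add]
    congr 2
    push_cast
    ring

lemma continuous_Mo (f : L2) : Continuous fun b : ℝ => Mo b f := by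
  have h : (fun b : ℝ => Mo b f) = fun b => fourierL2.symm (Tr b (fourierL2 f)) := by
    funext b
    rw [← fourierL2_Mo, LinearIsometryEquiv.symm_apply_apply]
  rw [h]
  exact fourierL2.symm.continuous.comp (continuous_Tr _)

lemma continuous_tf (f : L2) : Continuous fun z : ℝ × ℝ => tf z f := by
  unfold tf
  simp_rw [Tr_eq_compMeasurePreserving]
  let c : C((ℝ × ℝ) × ℝ, ℝ) := ⟨fun p => p.2 - p.1.1, by fun_prop⟩
  exact Continuous.compMeasurePreservingLp (f := fun z : ℝ × ℝ => Mo z.2 f)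
    (g := fun z => c.curry z) ((continuous_Mo f).comp continuous_snd) c.curry.continuous
    (fun z => measurePreserving_sub_right volume z.1) (by simp)

lemma tf_fst_zero (b : ℝ) (f : L2) : tf (0, b) f = Mo b f := by
  have h := tf_Mo 0 b f
  rw [tf_zero, zero_add] at h
  exact h.symm

lemma tf_snd_zero (a : ℝ) (f : L2) : tf (a, 0) f = Tr a f := by
  have h : Mo 0 f = f := by rw [← tf_fst_zero, Prod.mk_zero_zero, tf_zero]
  rw [tf, h]

lemma Mo_Tr (a b : ℝ) (f : L2) :
    Mo b (Tr a f) = Complex.exp (2 * Real.pi * Complex.I * (b * a)) • tf (a, b) f := by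
  rw [← tf_fst_zero, ← tf_snd_zero, tf_tf]
  simp

/-- The Fourier transform intertwines `ρ` along the rotation by a right angle. -/
lemma fourierL2_rho (z : ℝ × ℝ) (f : L2) :
    fourierL2 (rho z f) = rho (z.2, -z.1) (fourierL2 f) := by
  rw [rho, map_smul, tf, fourierL2_Tr, fourierL2_Mo, Mo_Tr, smul_smul, ← Complex.exp_add, rho]
  congr 2
  push_cast
  ring

/-- The short-time Fourier transform of `f` with window `ψ` is integrable. -/
def HasIntegrableSTFT (ψ f : L2) : Prop :=
  Integrable (fun z : ℝ × ℝ => ⟪f, tf z ψ⟫_ℂ) (volume : Measure (ℝ × ℝ))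

lemma continuous_stft (ψ f : L2) : Continuous fun z : ℝ × ℝ => ⟪f, tf z ψ⟫_ℂ :=
  continuous_const.inner (continuous_tf ψ)

lemma inS0_iff (f : L2) : InS0 f ↔ HasIntegrableSTFT gaussL2 f := by
  refine integrable_congr' ((continuous_tf _).inner continuous_const).aestronglyMeasurable
    (continuous_stft _ _).aestronglyMeasurable (Eventually.of_forall fun z => ?_)
  exact norm_inner_symm _ _

lemma HasIntegrableSTFT.of_smul {c : ℂ} (hc : c ≠ 0) {ψ f : L2}
    (h : HasIntegrableSTFT (c • ψ) f) : HasIntegrableSTFT ψ f := by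
  unfold HasIntegrableSTFT at h ⊢
  simp_rw [tf_smul, inner_smul_right] at h
  exact (integrable_const_mul_iff (isUnit_iff_ne_zero.2 hc) _).1 h

/-- A unitary intertwining `ρ` along `T` intertwines time-frequency shifts up to a phase. -/
lemma exists_tf_map_eq_smul {V : L2 ≃ₗᵢ[ℂ] L2} {T : ℝ × ℝ → ℝ × ℝ}
    (hV : ∀ z f, V (rho z f) = rho (T z) (V f)) (z : ℝ × ℝ) :
    ∃ c : ℂ, ‖c‖ = 1 ∧ ∀ f, tf (T z) (V f) = c • V (tf z f) := by
  refine ⟨(Complex.exp (Real.pi * Complex.I * ((T z).1 * (T z).2)))⁻¹ *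
    Complex.exp (Real.pi * Complex.I * (z.1 * z.2)), ?_, fun f => ?_⟩
  · rw [norm_mul, norm_inv, norm_rho_coeff, norm_rho_coeff, inv_one, mul_one]
  · rw [tf_eq_smul_rho, ← hV, rho, map_smul, smul_smul]

lemma norm_inner_tf_map {V : L2 ≃ₗᵢ[ℂ] L2} {T : ℝ × ℝ → ℝ × ℝ}
    (hV : ∀ z f, V (rho z f) = rho (T z) (V f)) (z : ℝ × ℝ) (ψ f : L2) :
    ‖⟪tf (T z) (V ψ), V f⟫_ℂ‖ = ‖⟪tf z ψ, f⟫_ℂ‖ := by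
  obtain ⟨c, hc, h⟩ := exists_tf_map_eq_smul hV z
  rw [h, inner_smul_left, LinearIsometryEquiv.inner_map_map, norm_mul, RCLike.norm_conj, hc,
    one_mul]

lemma hasIntegrableSTFT_map_iff {V : L2 ≃ₗᵢ[ℂ] L2} {T : ℝ × ℝ → ℝ × ℝ}
    (hV : ∀ z f, V (rho z f) = rho (T z) (V f)) (hT : MeasurePreserving T)
    (hTe : MeasurableEmbedding T) (ψ f : L2) :
    HasIntegrableSTFT (V ψ) (V f) ↔ HasIntegrableSTFT ψ f := by
  unfold HasIntegrableSTFT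
  rw [← hT.integrable_comp_emb hTe]
  refine integrable_congr' ?_ (continuous_stft _ _).aestronglyMeasurable
    (Eventually.of_forall fun z => ?_)
  · exact ((continuous_stft _ _).measurable.comp hTe.measurable).aestronglyMeasurable
  · rw [Function.comp_apply, norm_inner_symm, norm_inner_tf_map hV, norm_inner_symm]

lemma measurePreserving_rotate :
    MeasurePreserving (fun z : ℝ × ℝ => (z.2, -z.1)) := by
  have h := ((MeasurePreserving.id (volume : Measure ℝ)).prod
    (Measure.measurePreserving_neg (volume : Measure ℝ))).comp
    (Measure.measurePreserving_swap (μ := (volume : Measure ℝ)) (ν := (volume : Measure ℝ)))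
  exact h

lemma measurableEmbedding_rotate :
    MeasurableEmbedding (fun z : ℝ × ℝ => (z.2, -z.1)) :=
  Continuous.measurableEmbedding (by fun_prop) fun z w h => by
    simp only [Prod.mk.injEq, neg_inj] at h
    exact Prod.ext h.2 h.1

lemma measurePreserving_shear (s : ℝ) :
    MeasurePreserving (fun z : ℝ × ℝ => (z.1, s * z.1 + z.2)) :=
  (MeasurePreserving.id (volume : Measure ℝ)).skew_product (g := fun x y => s * x + y)
    (by fun_prop) (Eventually.of_forall fun x => (measurePreserving_add_left volume (s * x)).map_eq)

lemma measurableEmbedding_shear (s : ℝ) :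
    MeasurableEmbedding (fun z : ℝ × ℝ => (z.1, s * z.1 + z.2)) :=
  Continuous.measurableEmbedding (by fun_prop) fun z w h => by
    simp only [Prod.mk.injEq] at h
    obtain ⟨h1, h2⟩ := h
    rw [h1] at h2
    exact Prod.ext h1 (add_left_cancel h2)

lemma hasIntegrableSTFT_fourierL2_iff (ψ f : L2) :
    HasIntegrableSTFT (fourierL2 ψ) (fourierL2 f) ↔ HasIntegrableSTFT ψ f :=
  hasIntegrableSTFT_map_iff fourierL2_rho measurePreserving_rotate measurableEmbedding_rotate ψ f

lemma hasIntegrableSTFT_circleMul_iff (s : ℝ) (ψ f : L2) :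
    HasIntegrableSTFT (circleMul (quadPhase s) ψ) (circleMul (quadPhase s) f) ↔
      HasIntegrableSTFT ψ f :=
  hasIntegrableSTFT_map_iff (V := circleMulₗᵢ (quadPhase s)) (circleMul_quadPhase_rho s)
    (measurePreserving_shear s) (measurableEmbedding_shear s) ψ f

lemma integrable_mul_conj (ψ f : L2) : Integrable fun x => ψ x * conj (f x) := by
  simpa [RCLike.inner_apply] using L2.integrable_inner (𝕜 := ℂ) f ψ

lemma inner_Mo_eq_fourier (ψ f : L2) (v : ℝ) :
    ⟪f, Mo (-v) ψ⟫_ℂ = 𝓕 (fun x => ψ x * conj (f x)) v := by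
  rw [L2.inner_def, Real.fourier_real_eq_integral_exp_smul]
  refine integral_congr_ae ?_
  filter_upwards [coeFn_Mo (-v) ψ] with x hx
  rw [RCLike.inner_apply, hx, smul_eq_mul, mul_assoc]
  congr 2
  push_cast
  ring

/-- Multiplying the window by the Fourier transform of `h` averages the short-time Fourier
transform against `h` in the frequency variable. -/
lemma stft_mul_window {h : ℝ → ℂ} (hh : Integrable h) {ψ ψ' : L2}
    (hψ : ψ' =ᵐ[volume] fun x => 𝓕 h x * ψ x) (f : L2) (z : ℝ × ℝ) :
    ⟪f, tf z ψ'⟫_ℂ = ∫ v, h v * ⟪f, tf (z + (0, -v)) ψ⟫_ℂ := by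
  obtain ⟨f, rfl⟩ := tf_surjective z f
  simp_rw [← tf_Mo, inner_tf_tf, inner_Mo_eq_fourier]
  have hswap := integral_fourier_smul_eq_flip hh (integrable_mul_conj ψ f)
  simp only [smul_eq_mul] at hswap
  rw [← hswap, L2.inner_def]
  refine integral_congr_ae ?_
  filter_upwards [hψ] with x hx
  rw [RCLike.inner_apply, hx, mul_assoc]

lemma HasIntegrableSTFT.mul_window {h : ℝ → ℂ} (hh : Integrable h) {ψ ψ' f : L2}
    (hψ : ψ' =ᵐ[volume] fun x => 𝓕 h x * ψ x) (hf : HasIntegrableSTFT ψ f) :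
    HasIntegrableSTFT ψ' f := by
  unfold HasIntegrableSTFT
  simp_rw [stft_mul_window hh hψ]
  have hT : MeasurePreserving (fun p : ℝ × (ℝ × ℝ) => (p.1, p.2 + (0, -p.1))) :=
    (MeasurePreserving.id (volume : Measure ℝ)).skew_product
      (g := fun v (z : ℝ × ℝ) => z + (0, -v)) (by fun_prop)
      (Eventually.of_forall fun v => (measurePreserving_add_right volume _).map_eq)
  exact (hT.integrable_comp_of_integrable (hh.mul_prod hf)).integral_prod_right

lemma norm_gaussian (τ : ℂ) (x : ℝ) :
    ‖Complex.exp (-Real.pi * τ * x ^ 2)‖ = Real.exp (-(Real.pi * τ.re) * x ^ 2) := by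
  rw [Complex.norm_exp]
  congr 1
  rw [show (-Real.pi * τ * x ^ 2 : ℂ) = ((-Real.pi * x ^ 2 : ℝ) : ℂ) * τ by push_cast; ring,
    Complex.re_ofReal_mul]
  ring

lemma integrable_gaussian {τ : ℂ} (hτ : 0 < τ.re) :
    Integrable fun x : ℝ => Complex.exp (-Real.pi * τ * x ^ 2) := by
  refine (integrable_exp_neg_mul_sq (b := Real.pi * τ.re) (by positivity)).mono'
    (Continuous.aestronglyMeasurable (by fun_prop)) (Eventually.of_forall fun x => ?_)
  rw [norm_gaussian]

lemma memLp_gaussian_complex {τ : ℂ} (hτ : 0 < τ.re) :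
    MemLp (fun x : ℝ => Complex.exp (-Real.pi * τ * x ^ 2)) 2 volume := by
  rw [memLp_two_iff_integrable_sq_norm (Continuous.aestronglyMeasurable (by fun_prop))]
  refine (integrable_exp_neg_mul_sq (b := 2 * (Real.pi * τ.re)) (by positivity)).congr
    (Eventually.of_forall fun x => ?_)
  change Real.exp (-(2 * (Real.pi * τ.re)) * x ^ 2) = ‖Complex.exp (-Real.pi * τ * x ^ 2)‖ ^ 2
  rw [norm_gaussian, ← Real.exp_nat_mul]
  congr 1
  push_cast
  ring

/-- The Gaussian `x ↦ e^{-πτx²}` as an element of `L²(ℝ)`. -/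
def gaussWindow (τ : ℂ) (hτ : 0 < τ.re) : L2 := (memLp_gaussian_complex hτ).toLp _

lemma coeFn_gaussWindow (τ : ℂ) (hτ : 0 < τ.re) :
    gaussWindow τ hτ =ᵐ[volume] fun x => Complex.exp (-Real.pi * τ * x ^ 2) :=
  MemLp.coeFn_toLp _

lemma gaussL2_eq : gaussL2 = gaussWindow 1 (by simp) := by
  refine Lp.ext ?_
  filter_upwards [memLp_gaussian.coeFn_toLp, coeFn_gaussWindow 1 (by simp)] with x h1 h2
  rw [gaussL2, h1, h2]
  push_cast
  ring_nf

lemma inv_re_pos {τ : ℂ} (hτ : 0 < τ.re) : 0 < (1 / τ).re := by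
  have h : τ ≠ 0 := fun h => by simp [h] at hτ
  rw [one_div, Complex.inv_re]
  exact div_pos hτ (Complex.normSq_pos.2 h)

lemma gaussian_coeff_ne_zero {τ : ℂ} (hτ : 0 < τ.re) : 1 / τ ^ (1 / 2 : ℂ) ≠ 0 := by
  have h : τ ≠ 0 := fun h => by simp [h] at hτ
  exact one_div_ne_zero (Complex.cpow_ne_zero_iff.2 (Or.inl h))

lemma fourierL2_gaussWindow {τ : ℂ} (hτ : 0 < τ.re) :
    fourierL2 (gaussWindow τ hτ) =
      (1 / τ ^ (1 / 2 : ℂ)) • gaussWindow (1 / τ) (inv_re_pos hτ) := by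
  refine fourierL2_eq_of_ae (coeFn_gaussWindow τ hτ) (integrable_gaussian hτ) ?_
  rw [fourier_gaussian_pi hτ]
  filter_upwards [Lp.coeFn_smul (1 / τ ^ (1 / 2 : ℂ)) (gaussWindow (1 / τ) (inv_re_pos hτ)),
    coeFn_gaussWindow (1 / τ) (inv_re_pos hτ)] with x h1 h2
  rw [h1, Pi.smul_apply, h2, smul_eq_mul]
  ring_nf

lemma HasIntegrableSTFT.gaussWindow_add {τ σ : ℂ} (hτ : 0 < τ.re) (hσ : 0 < σ.re)
    (hτσ : 0 < (τ + σ).re) {f : L2}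
    (hf : HasIntegrableSTFT (gaussWindow τ hτ) f) :
    HasIntegrableSTFT (gaussWindow (τ + σ) hτσ) f := by
  have hσ' := inv_re_pos hσ
  set c : ℂ := 1 / (1 / σ) ^ (1 / 2 : ℂ)
  have hc : c ≠ 0 := gaussian_coeff_ne_zero hσ'
  refine (hf.mul_window (ψ' := c • gaussWindow (τ + σ) hτσ) (integrable_gaussian hσ') ?_).of_smul hc
  rw [fourier_gaussian_pi hσ']
  filter_upwards [Lp.coeFn_smul c (gaussWindow (τ + σ) hτσ), coeFn_gaussWindow (τ + σ) hτσ,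
    coeFn_gaussWindow τ hτ] with x h1 h2 h3
  rw [h1, Pi.smul_apply, h2, h3, smul_eq_mul, mul_assoc c, ← Complex.exp_add]
  congr 2
  rw [div_div_eq_mul_div]
  ring

lemma gaussWindow_congr {τ σ : ℂ} (h : τ = σ) (hτ : 0 < τ.re) (hσ : 0 < σ.re) :
    gaussWindow τ hτ = gaussWindow σ hσ := by
  subst h
  rfl

lemma fourierL2_gaussL2 : fourierL2 gaussL2 = gaussL2 := by
  have h : 1 / (1 : ℂ) ^ (1 / 2 : ℂ) = 1 := by simp
  rw [gaussL2_eq, fourierL2_gaussWindow, h, one_smul]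
  exact gaussWindow_congr (by simp) _ _

lemma InS0.fourierL2 {f : L2} (hf : InS0 f) : InS0 (fourierL2 f) := by
  rw [inS0_iff] at hf ⊢
  rw [← fourierL2_gaussL2]
  exact (hasIntegrableSTFT_fourierL2_iff _ _).2 hf

/-- Functions in `S₀` have integrable short-time Fourier transform for chirped Gaussian windows. -/
lemma InS0.gaussWindow {f : L2} (hf : InS0 f) (τ : ℂ) (hτ : 1 / 2 < τ.re) :
    HasIntegrableSTFT (gaussWindow τ (by linarith)) f := by
  have hre2 : 0 < (2 : ℂ).re := by norm_num
  have h1 : HasIntegrableSTFT gaussL2 (_root_.fourierL2.symm f) := by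
    rw [← hasIntegrableSTFT_fourierL2_iff, fourierL2_gaussL2,
      LinearIsometryEquiv.apply_symm_apply]
    exact (inS0_iff f).1 hf
  have h2 : HasIntegrableSTFT (_root_.gaussWindow 2 hre2) (_root_.fourierL2.symm f) := by
    rw [gaussL2_eq] at h1
    rw [gaussWindow_congr (show (2 : ℂ) = 1 + 1 by norm_num) hre2 (by norm_num)]
    exact h1.gaussWindow_add _ (by norm_num) _
  rw [← hasIntegrableSTFT_fourierL2_iff, LinearIsometryEquiv.apply_symm_apply,
    fourierL2_gaussWindow] at h2
  have h3 := (h2.of_smul (gaussian_coeff_ne_zero hre2)).gaussWindow_add (σ := τ - 1 / 2) _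
    (by simp only [one_div, Complex.sub_re, Complex.inv_re]; norm_num; linarith)
    (by simpa using by linarith)
  rwa [gaussWindow_congr (show 1 / 2 + (τ - 1 / 2) = τ by ring) _ (by linarith)] at h3

lemma circleMul_quadPhase_gaussWindow (s : ℝ) :
    circleMul (quadPhase s) (gaussWindow (1 + s * Complex.I) (by simp)) = gaussL2 := by
  rw [gaussL2_eq]
  refine Lp.ext ?_
  filter_upwards [coeFn_circleMul (quadPhase s) (gaussWindow (1 + s * Complex.I) (by simp)),
    coeFn_gaussWindow (1 + s * Complex.I) (by simp), coeFn_gaussWindow 1 (by simp)] with x h1 h2 h3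
  rw [h1, h2, h3, quadPhase_apply, ← Complex.exp_add]
  ring_nf

lemma InS0.circleMul {f : L2} (hf : InS0 f) (s : ℝ) : InS0 (circleMul (quadPhase s) f) := by
  rw [inS0_iff, ← circleMul_quadPhase_gaussWindow s, hasIntegrableSTFT_circleMul_iff]
  exact hf.gaussWindow _ (by norm_num)

/-- The closed linear span of a Gabor system as a submodule. -/
def gaborSubmodule (g : L2) (Λ : Set (ℝ × ℝ)) : Submodule ℂ L2 :=
  (Submodule.span ℂ ((fun z => tf z g) '' Λ)).topologicalClosure

lemma mem_gaborSpan_iff {g f : L2} {Λ : Set (ℝ × ℝ)} :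
    f ∈ gaborSpan g Λ ↔ f ∈ gaborSubmodule g Λ := Iff.rfl

lemma tf_mem_gaborSubmodule (g : L2) {Λ : Set (ℝ × ℝ)} {z : ℝ × ℝ} (hz : z ∈ Λ) :
    tf z g ∈ gaborSubmodule g Λ :=
  Submodule.le_topologicalClosure _ (Submodule.subset_span ⟨z, hz, rfl⟩)

lemma map_mem_gaborSubmodule {g g' : L2} {Λ Λ' : Set (ℝ × ℝ)} {P : L2 →ₗ[ℂ] L2}
    (hP : Continuous P) (h : ∀ z ∈ Λ, P (tf z g) ∈ gaborSubmodule g' Λ') {f : L2}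
    (hf : f ∈ gaborSubmodule g Λ) : P f ∈ gaborSubmodule g' Λ' := by
  have hle : gaborSubmodule g Λ ≤ (gaborSubmodule g' Λ').comap P := by
    refine Submodule.topologicalClosure_minimal _ (Submodule.span_le.2 ?_) ?_
    · rintro _ ⟨z, hz, rfl⟩
      exact h z hz
    · exact (Submodule.isClosed_topologicalClosure _).preimage hP
  exact hle hf

lemma isClosed_stab_gaborSpan (g : L2) (Λ : Set (ℝ × ℝ)) : IsClosed (stab (gaborSpan g Λ)) := by
  have h : stab (gaborSpan g Λ) = ⋂ f ∈ gaborSpan g Λ, (fun z => tf z f) ⁻¹' gaborSpan g Λ := by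
    ext z
    simp [stab]
  rw [h]
  exact isClosed_biInter fun f _ => isClosed_closure.preimage (continuous_tf f)

lemma tf_add (z w : ℝ × ℝ) (f : L2) :
    tf (z + w) f = (Complex.exp (2 * Real.pi * Complex.I * (z.2 * w.1)))⁻¹ • tf z (tf w f) := by
  rw [tf_tf, inv_smul_smul₀ (Complex.exp_ne_zero _)]

lemma add_mem_stab_gaborSpan {g : L2} {Λ : Set (ℝ × ℝ)} {z w : ℝ × ℝ}
    (hz : z ∈ stab (gaborSpan g Λ)) (hw : w ∈ stab (gaborSpan g Λ)) :
    z + w ∈ stab (gaborSpan g Λ) := by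
  intro f hf
  rw [tf_add, mem_gaborSpan_iff]
  exact Submodule.smul_mem _ _ (hz _ (hw f hf))

lemma subset_stab_gaborSpan (g : L2) {Λ : Set (ℝ × ℝ)}
    (hadd : ∀ z ∈ Λ, ∀ w ∈ Λ, z + w ∈ Λ) : Λ ⊆ stab (gaborSpan g Λ) := by
  intro z hz f hf
  rw [tf_eq_tfₗᵢ, mem_gaborSpan_iff]
  refine map_mem_gaborSubmodule (P := (tfₗᵢ z).toLinearMap) (tfₗᵢ z).continuous (fun w hw => ?_) hf
  change tfₗᵢ z (tf w g) ∈ _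
  rw [← tf_eq_tfₗᵢ, tf_tf]
  exact Submodule.smul_mem _ _ (tf_mem_gaborSubmodule g (hadd z hz w hw))

section Transport

variable {V : L2 ≃ₗᵢ[ℂ] L2} {T : ℝ × ℝ → ℝ × ℝ} {g : L2} {Λ : Set (ℝ × ℝ)}

lemma exists_map_tf_eq_smul (hV : ∀ z f, V (rho z f) = rho (T z) (V f))
    (z : ℝ × ℝ) :
    ∃ c : ℂ, ∀ f, V (tf z f) = c • tf (T z) (V f) := by
  obtain ⟨c, hc, h⟩ := exists_tf_map_eq_smul hV z
  have hc0 : c ≠ 0 := norm_ne_zero_iff.1 (by rw [hc]; exact one_ne_zero)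
  exact ⟨c⁻¹, fun f => by rw [h, inv_smul_smul₀ hc0]⟩

lemma map_mem_gaborSpan_image (hV : ∀ z f, V (rho z f) = rho (T z) (V f))
    {f : L2} (hf : f ∈ gaborSpan g Λ) :
    V f ∈ gaborSpan (V g) (T '' Λ) := by
  rw [mem_gaborSpan_iff] at hf ⊢
  refine map_mem_gaborSubmodule (P := V.toLinearEquiv.toLinearMap) V.continuous (fun z hz => ?_) hf
  obtain ⟨c, h⟩ := exists_map_tf_eq_smul hV z
  change V (tf z g) ∈ _
  rw [h]
  exact Submodule.smul_mem _ _ (tf_mem_gaborSubmodule _ ⟨z, hz, rfl⟩)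

lemma symm_mem_gaborSpan_of_image (hV : ∀ z f, V (rho z f) = rho (T z) (V f))
    {f : L2} (hf : f ∈ gaborSpan (V g) (T '' Λ)) :
    V.symm f ∈ gaborSpan g Λ := by
  rw [mem_gaborSpan_iff] at hf ⊢
  refine map_mem_gaborSubmodule (P := V.symm.toLinearEquiv.toLinearMap) V.symm.continuous ?_ hf
  rintro _ ⟨z, hz, rfl⟩
  obtain ⟨c, -, h⟩ := exists_tf_map_eq_smul hV z
  change V.symm (tf (T z) (V g)) ∈ _
  rw [h, map_smul, LinearIsometryEquiv.symm_apply_apply]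
  exact Submodule.smul_mem _ _ (tf_mem_gaborSubmodule g hz)

lemma isFrameSeq_image (hV : ∀ z f, V (rho z f) = rho (T z) (V f))
    (hT : Function.Injective T) (hg : IsFrameSeq g Λ) :
    IsFrameSeq (V g) (T '' Λ) := by
  obtain ⟨a, b, ha, hb, h⟩ := hg
  refine ⟨a, b, ha, hb, fun f hf => ?_⟩
  have hsum : ∑' lam : T '' Λ, ‖⟪tf (lam : ℝ × ℝ) (V g), f⟫_ℂ‖ ^ 2 =
      ∑' lam : Λ, ‖⟪tf (lam : ℝ × ℝ) g, V.symm f⟫_ℂ‖ ^ 2 := by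
    rw [tsum_image (fun lam => ‖⟪tf lam (V g), f⟫_ℂ‖ ^ 2) hT.injOn]
    refine tsum_congr fun lam => ?_
    rw [← norm_inner_tf_map hV _ g (V.symm f), LinearIsometryEquiv.apply_symm_apply]
  rw [hsum, ← LinearIsometryEquiv.norm_map V.symm f]
  exact h _ (symm_mem_gaborSpan_of_image hV hf)

lemma tf_mem_gaborSpan_image (hV : ∀ z f, V (rho z f) = rho (T z) (V f))
    (h0 : (0 : ℝ × ℝ) ∈ Λ) {z : ℝ × ℝ}
    (hz : z ∈ stab (gaborSpan g Λ)) : tf (T z) (V g) ∈ gaborSpan (V g) (T '' Λ) := by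
  obtain ⟨c, -, h⟩ := exists_tf_map_eq_smul hV z
  have hg : g ∈ gaborSpan g Λ := by
    have := tf_mem_gaborSubmodule g h0
    rwa [tf_zero] at this
  rw [h, mem_gaborSpan_iff]
  exact Submodule.smul_mem _ _ (map_mem_gaborSpan_image hV (hz g hg))

end Transport

/-- The unitary implementing the matrix `[[a, 1], [a d - 1, d]]`. -/
def chirpFourierL2 (a d : ℝ) : L2 ≃ₗᵢ[ℂ] L2 :=
  ((circleMulₗᵢ (quadPhase a)).trans fourierL2).trans (circleMulₗᵢ (quadPhase d))

lemma chirpFourierL2_apply (a d : ℝ) (f : L2) : chirpFourierL2 a d f =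
    circleMul (quadPhase d) (fourierL2 (circleMul (quadPhase a) f)) := rfl

lemma chirpFourierL2_rho (a d : ℝ) (z : ℝ × ℝ) (f : L2) :
    chirpFourierL2 a d (rho z f) =
      rho (a * z.1 + z.2, (a * d - 1) * z.1 + d * z.2) (chirpFourierL2 a d f) := by
  simp only [chirpFourierL2_apply, circleMul_quadPhase_rho, fourierL2_rho]
  congr 2
  ring

lemma InS0.chirpFourierL2 {f : L2} (hf : InS0 f) (a d : ℝ) : InS0 (chirpFourierL2 a d f) :=
  ((hf.circleMul a).fourierL2).circleMul d

/-- The set of integer combinations of `v` and `w`. -/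
def intSpan (v w : ℝ × ℝ) : Set (ℝ × ℝ) := {x | ∃ k l : ℤ, x = (k : ℝ) • v + (l : ℝ) • w}

lemma add_mem_intSpan (v w : ℝ × ℝ) : ∀ x ∈ intSpan v w, ∀ y ∈ intSpan v w,
    x + y ∈ intSpan v w := by
  rintro _ ⟨k, l, rfl⟩ _ ⟨k', l', rfl⟩
  refine ⟨k + k', l + l', ?_⟩
  push_cast
  module

lemma zero_mem_intSpan (v w : ℝ × ℝ) : 0 ∈ intSpan v w := ⟨0, 0, by simp⟩

/-- The determinant of two vectors of the plane. -/
def det2 (v w : ℝ × ℝ) : ℝ := v.1 * w.2 - w.1 * v.2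

lemma IsLattice.exists_basis {Λ : Set (ℝ × ℝ)} (h : IsLattice Λ) :
    ∃ v w : ℝ × ℝ, det2 v w ≠ 0 ∧ Λ = intSpan v w := by
  obtain ⟨A, hA, rfl⟩ := h
  refine ⟨(A 0 0, A 1 0), (A 0 1, A 1 1), ?_, ?_⟩
  · rw [Matrix.det_fin_two] at hA
    exact hA.ne_zero
  · ext x
    simp [intSpan, mul_comm]

lemma exists_coords {v w : ℝ × ℝ} (h : det2 v w ≠ 0) (z : ℝ × ℝ) :
    ∃ x : ℝ × ℝ, z = x.1 • v + x.2 • w := by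
  refine ⟨(det2 z w / det2 v w, det2 v z / det2 v w), Prod.ext ?_ ?_⟩ <;>
  · simp only [Prod.fst_add, Prod.snd_add, Prod.smul_fst, Prod.smul_snd, smul_eq_mul]
    field_simp
    simp only [det2]
    ring

lemma intSpan_unimodular (v w : ℝ × ℝ) {p q r s e : ℤ} (h : e * (p * s - q * r) = 1) :
    intSpan ((p : ℝ) • v + (q : ℝ) • w) ((r : ℝ) • v + (s : ℝ) • w) = intSpan v w := by
  have hR : (e : ℝ) * (p * s - q * r) = 1 := by exact_mod_cast h
  ext x
  constructor
  · rintro ⟨k, l, rfl⟩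
    refine ⟨k * p + l * r, k * q + l * s, ?_⟩
    push_cast
    module
  · rintro ⟨k, l, rfl⟩
    refine ⟨e * (k * s - l * r), e * (l * p - k * q), ?_⟩
    push_cast
    refine Prod.ext ?_ ?_ <;>
      simp only [Prod.fst_add, Prod.snd_add, Prod.smul_fst, Prod.smul_snd, smul_eq_mul]
    · linear_combination (-(k * v.1 + l * w.1)) * hR
    · linear_combination (-(k * v.2 + l * w.2)) * hR

lemma det2_unimodular (v w : ℝ × ℝ) (p q r s : ℝ) :
    det2 (p • v + q • w) (r • v + s • w) = (p * s - q * r) * det2 v w := by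
  simp only [det2, Prod.fst_add, Prod.snd_add, Prod.smul_fst, Prod.smul_snd, smul_eq_mul]
  ring

/-- A closed additive set properly containing a lattice contains a proper fraction of the first
vector of some lattice basis, and its opposite. -/
lemma exists_basis_div_mem {v₀ w₀ : ℝ × ℝ} (h₀ : det2 v₀ w₀ ≠ 0) {S : Set (ℝ × ℝ)}
    (hcl : IsClosed S) (hadd : ∀ x ∈ S, ∀ y ∈ S, x + y ∈ S) (hsub : intSpan v₀ w₀ ⊆ S)
    (hne : S ≠ intSpan v₀ w₀) :
    ∃ v w : ℝ × ℝ, ∃ m : ℕ, det2 v w ≠ 0 ∧ intSpan v w = intSpan v₀ w₀ ∧ 2 ≤ m ∧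
      (m : ℝ)⁻¹ • v ∈ S ∧ (m : ℝ)⁻¹ • (-v) ∈ S := by
  let φ : ℝ × ℝ → ℝ × ℝ := fun x => x.1 • v₀ + x.2 • w₀
  have hφadd : ∀ x y, φ (x + y) = φ x + φ y := fun x y => by
    simp only [φ, Prod.fst_add, Prod.snd_add]
    module
  have hcl' : IsClosed (φ ⁻¹' S) := hcl.preimage (by fun_prop)
  have hadd' : ∀ x ∈ φ ⁻¹' S, ∀ y ∈ φ ⁻¹' S, x + y ∈ φ ⁻¹' S := fun x hx y hy => by
    rw [Set.mem_preimage, hφadd]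
    exact hadd _ hx _ hy
  have hZ : ∀ k l : ℤ, ((k : ℝ), (l : ℝ)) ∈ φ ⁻¹' S := fun k l => hsub ⟨k, l, rfl⟩
  let H : AddSubgroup (ℝ × ℝ) :=
    { carrier := φ ⁻¹' S
      add_mem' := fun {x y} hx hy => hadd' x hx y hy
      zero_mem' := by simpa [← Prod.zero_eq_mk] using hZ 0 0
      neg_mem' := fun {x} hx => neg_mem_of_closed_of_add_mem hcl' hadd' hZ hx }
  obtain ⟨z, hzS, hz⟩ := Set.not_subset.1 fun h => hne (h.antisymm hsub)
  obtain ⟨x, hx⟩ := exists_coords h₀ z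
  obtain ⟨p, q, ⟨s, r, hpq⟩, m, hm, hmem⟩ := exists_coprime_div_mem H hcl' hZ (z := x)
    (show x.1 • v₀ + x.2 • w₀ ∈ S from hx ▸ hzS) (by
      rintro ⟨k, l, rfl⟩
      exact hz ⟨k, l, hx⟩)
  have huni : 1 * (p * s - q * -r) = 1 := by linear_combination hpq
  refine ⟨(p : ℝ) • v₀ + (q : ℝ) • w₀, ((-r : ℤ) : ℝ) • v₀ + (s : ℝ) • w₀, m, ?_,
    intSpan_unimodular v₀ w₀ huni, hm, ?_, ?_⟩
  · have huniR : (p : ℝ) * s - q * (-r : ℤ) = 1 := by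
      exact_mod_cast (one_mul (p * s - q * -r)).symm.trans huni
    rw [det2_unimodular, huniR, one_mul]
    exact h₀
  · convert show φ _ ∈ S from hmem using 1
    simp only [φ, div_eq_inv_mul]
    module
  · convert show φ _ ∈ S from H.neg_mem hmem using 1
    simp only [φ, div_eq_inv_mul, Prod.neg_mk]
    module

/-- As `exists_basis_div_mem`, with a basis normalised in sign. -/
lemma exists_oriented_basis_div_mem {v₀ w₀ : ℝ × ℝ} (h₀ : det2 v₀ w₀ ≠ 0) {S : Set (ℝ × ℝ)}
    (hcl : IsClosed S) (hadd : ∀ x ∈ S, ∀ y ∈ S, x + y ∈ S) (hsub : intSpan v₀ w₀ ⊆ S)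
    (hne : S ≠ intSpan v₀ w₀) :
    ∃ v w : ℝ × ℝ, ∃ m : ℕ, 0 < det2 v w ∧ w.1 < 0 ∧ intSpan v w = intSpan v₀ w₀ ∧ 2 ≤ m ∧
      (m : ℝ)⁻¹ • v ∈ S := by
  obtain ⟨v, w, m, hdet, hspan, hm, hmem, hmem'⟩ := exists_basis_div_mem h₀ hcl hadd hsub hne
  obtain ⟨w, hdet, hspan, hw⟩ : ∃ w, det2 v w ≠ 0 ∧ intSpan v w = intSpan v₀ w₀ ∧ w.1 ≠ 0 := by
    by_cases hw : w.1 = 0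
    · have h := intSpan_unimodular v w (p := 1) (q := 0) (r := 1) (s := 1) (e := 1) (by norm_num)
      refine ⟨v + w, ?_, ?_, ?_⟩
      · convert hdet using 1
        simp only [det2, Prod.fst_add, Prod.snd_add]
        ring
      · simpa [hspan] using h
      · intro h0
        apply hdet
        simp only [Prod.fst_add, hw, add_zero] at h0
        simp [det2, h0, hw]
    · exact ⟨w, hdet, hspan, hw⟩
  obtain ⟨w, hdet, hspan, hw⟩ : ∃ w, det2 v w ≠ 0 ∧ intSpan v w = intSpan v₀ w₀ ∧ w.1 < 0 := by
    rcases lt_or_gt_of_ne hw with hw | hw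
    · exact ⟨w, hdet, hspan, hw⟩
    · have h := intSpan_unimodular v w (p := 1) (q := 0) (r := 0) (s := -1) (e := -1) (by norm_num)
      refine ⟨-w, ?_, ?_, by simpa using hw⟩
      · intro h0
        apply hdet
        simp only [det2, Prod.fst_neg, Prod.snd_neg] at h0 ⊢
        linarith
      · simpa [hspan] using h
  rcases lt_or_gt_of_ne hdet with hdet | hdet
  · have h := intSpan_unimodular v w (p := -1) (q := 0) (r := 0) (s := 1) (e := -1) (by norm_num)
    refine ⟨-v, w, m, ?_, hw, by simpa [hspan] using h, hm, hmem'⟩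
    simp only [det2, Prod.fst_neg, Prod.snd_neg] at hdet ⊢
    linarith
  · exact ⟨v, w, m, hdet, hw, hspan, hm, hmem⟩

/-- reduction to a separable lattice and an additional
time-frequency shift of the form `T_{α/m}`. -/
theorem statement_8 (g : L2) (hg : InS0 g) (Λ : Set (ℝ × ℝ)) (hΛ : IsLattice Λ)
    (hframe : IsFrameSeq g Λ) (hne : stab (gaborSpan g Λ) ≠ Λ) :
    ∃ (B : Matrix (Fin 2) (Fin 2) ℝ) (α β : ℝ) (m : ℕ) (U : L2 ≃ₗᵢ[ℂ] L2),
      B.det = 1 ∧ 0 < α ∧ 0 < β ∧ 2 ≤ m ∧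
      (fun p : ℝ × ℝ => ((B 0 0) * p.1 + (B 0 1) * p.2, (B 1 0) * p.1 + (B 1 1) * p.2)) '' Λ
          = sepLattice α β ∧
      (∀ (z : ℝ × ℝ) (f : L2),
        U (rho z f)
          = rho ((B 0 0) * z.1 + (B 0 1) * z.2, (B 1 0) * z.1 + (B 1 1) * z.2) (U f)) ∧
      InS0 (U g) ∧
      IsFrameSeq (U g) (sepLattice α β) ∧
      Tr (α / m) (U g) ∈ gaborSpan (U g) (sepLattice α β) := by
  obtain ⟨v₀, w₀, h₀, rfl⟩ := hΛ.exists_basis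
  obtain ⟨v, w, m, hdet, hw, hspan, hm, hmem⟩ := exists_oriented_basis_div_mem h₀
    (isClosed_stab_gaborSpan g _) (fun x hx y hy => add_mem_stab_gaborSpan hx hy)
    (subset_stab_gaborSpan g (add_mem_intSpan v₀ w₀)) hne
  rw [← hspan] at hframe hmem ⊢
  set Δ := det2 v w with hΔ
  have hw0 : w.1 ≠ 0 := hw.ne
  obtain ⟨a, ha⟩ : ∃ a, a = -w.2 / w.1 := ⟨_, rfl⟩
  obtain ⟨d, hd⟩ : ∃ d, d = -w.1 * v.1 / Δ := ⟨_, rfl⟩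
  let T : ℝ × ℝ → ℝ × ℝ := fun z => (a * z.1 + z.2, (a * d - 1) * z.1 + d * z.2)
  have hT : Function.Injective T := fun x y h => by
    obtain ⟨h1, h2⟩ := Prod.mk.inj h
    exact Prod.ext (by linear_combination d * h1 - h2)
      (by linear_combination (1 - a * d) * h1 + a * h2)
  have hTcomb : ∀ k l : ℝ, T (k • v + l • w) = (-Δ / w.1 * k, -w.1 * l) := fun k l => by
    refine Prod.ext ?_ ?_ <;>
      simp only [T, ha, hd, Prod.fst_add, Prod.snd_add, Prod.smul_fst, Prod.smul_snd, smul_eq_mul]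
    · field_simp
      simp only [hΔ, det2]
      ring
    · field_simp
      simp only [hΔ, det2]
      ring
  have himage : T '' intSpan v w = sepLattice (-Δ / w.1) (-w.1) := by
    ext x
    constructor
    · rintro ⟨_, ⟨k, l, rfl⟩, rfl⟩
      exact ⟨k, l, hTcomb k l⟩
    · rintro ⟨k, l, rfl⟩
      exact ⟨_, ⟨k, l, rfl⟩, hTcomb k l⟩
  have hV : ∀ z f, chirpFourierL2 a d (rho z f) = rho (T z) (chirpFourierL2 a d f) :=
    chirpFourierL2_rho a d
  refine ⟨!![a, 1; a * d - 1, d], -Δ / w.1, -w.1, m, chirpFourierL2 a d, ?_,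
    div_pos_of_neg_of_neg (neg_lt_zero.2 hdet) hw, neg_pos.2 hw, hm, ?_, ?_,
    hg.chirpFourierL2 a d, himage ▸ isFrameSeq_image hV hT hframe, ?_⟩
  · rw [Matrix.det_fin_two_of]
    ring
  · simpa [T] using himage
  · simpa [T] using hV
  · have h := tf_mem_gaborSpan_image hV (zero_mem_intSpan v w) hmem
    have hv := hTcomb (m : ℝ)⁻¹ 0
    rw [zero_smul, add_zero, mul_zero, ← div_eq_mul_inv] at hv
    rwa [hv, tf_snd_zero, himage] at h

end
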